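/- Let N, d ∈ ℕ, k < d, and ε ≥ η > 0. Let φ : (ℤ/Nℤ)^d → 𝕋^d be the homomorphism φ(x₁,…,x_d) = (x₁/N, …, x_d/N), let Q_{N,ε} := [ε, 1/N − ε)^d ⊆ 𝕋^d, and for A ⊆ (ℤ/Nℤ)^d let A^□_ε := φ(A) + Q_{N,ε}. Let U := Hamm(k, η) ⊆ 𝕋^d and let H_k ⊆ (ℤ/Nℤ)^d be the Hamming ball of radius k. Then (i) A^□_ε + U ⊆ (A + H_k)^□_0, and (ii) if ε > η then the topological closure of A^□_ε + U is contained in (A + H_k)^□_0. -/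

import Mathlib

open Pointwise

/-- The homomorphism `φ : (ℤ/Nℤ)^d → 𝕋^d`, `φ(x₁,…,x_d) = (x₁/N, …, x_d/N)`. -/
noncomputable def phiMap (N d : ℕ) (x : Fin d → ZMod N) : Fin d → AddCircle (1 : ℝ) :=
  fun j => (((x j).val : ℝ) / N : ℝ)

/-- The cube `Q_{N,ε} = [ε, 1/N − ε)^d ⊆ 𝕋^d` (the image in `𝕋^d` of the
corresponding cube in `ℝ^d`). -/
def cube (N d : ℕ) (ε : ℝ) : Set (Fin d → AddCircle (1 : ℝ)) :=
  {y | ∀ j, ∃ r : ℝ, ε ≤ r ∧ r < 1 / N - ε ∧ y j = (r : AddCircle (1 : ℝ))}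

/-- `A^□_ε := φ(A) + Q_{N,ε} ⊆ 𝕋^d`. -/
noncomputable def sqSet (N d : ℕ) (ε : ℝ) (A : Set (Fin d → ZMod N)) :
    Set (Fin d → AddCircle (1 : ℝ)) :=
  (phiMap N d) '' A + cube N d ε

/-- The approximate Hamming ball `Hamm(k, η) ⊆ 𝕋^d`: points with at most `k`
coordinates at distance at least `η` from `0`. -/
def approxHamming (d k : ℕ) (η : ℝ) : Set (Fin d → AddCircle (1 : ℝ)) :=
  {x | Set.ncard {j : Fin d | η ≤ ‖x j‖} ≤ k}

/-- The Hamming ball of radius `k` around `0` in `(ℤ/Nℤ)^d`: elements with at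
most `k` nonzero coordinates. -/
def hammingBall (N d k : ℕ) : Set (Fin d → ZMod N) :=
  {x | Set.ncard {j : Fin d | x j ≠ 0} ≤ k}

lemma aux_lift (u : AddCircle (1 : ℝ)) (η : ℝ) (h : ‖u‖ < η) :
    ∃ t : ℝ, |t| < η ∧ u = (t : AddCircle (1 : ℝ)) := by
  obtain ⟨x, rfl⟩ := QuotientAddGroup.mk_surjective u
  refine ⟨x - round x, ?_, ?_⟩
  · have := AddCircle.norm_eq (p := (1 : ℝ)) (x := x)
    simp only [inv_one, one_mul, mul_one] at this
    rw [← this]; exact h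
  · have h1 : ((round x : ℝ) : AddCircle (1 : ℝ)) = 0 := by
      rw [AddCircle.coe_eq_zero_iff]
      exact ⟨round x, by simp⟩
    rw [AddCircle.coe_sub, h1, sub_zero]

lemma aux_cell (N : ℕ) (hN : 0 < N) (z : AddCircle (1 : ℝ)) :
    ∃ (m : ZMod N) (s : ℝ), 0 ≤ s ∧ s < 1 / N ∧
      z = (((m.val : ℝ) / N : ℝ) : AddCircle (1 : ℝ)) + (s : AddCircle (1 : ℝ)) := by
  obtain ⟨x, rfl⟩ := QuotientAddGroup.mk_surjective z
  have : NeZero N := ⟨hN.ne'⟩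
  have hN' : (0 : ℝ) < N := by exact_mod_cast hN
  set n : ℤ := ⌊(N : ℝ) * x⌋ with hn
  have h1 := Int.floor_le ((N : ℝ) * x)
  have h2 := Int.lt_floor_add_one ((N : ℝ) * x)
  rw [← hn] at h1 h2
  refine ⟨(n : ZMod N), x - n / N, ?_, ?_, ?_⟩
  · rw [sub_nonneg, div_le_iff₀ hN']; linarith
  · rw [sub_lt_iff_lt_add, ← add_div, lt_div_iff₀ hN']; linarith
  · have hv : (((n : ZMod N).val : ℤ) : ℝ) = ((n % N : ℤ) : ℝ) := by
      rw [ZMod.val_intCast]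
    have hv2 : ((n % N : ℤ) : ℝ) = n - N * ((n / N : ℤ) : ℝ) := by
      have := Int.emod_def n N
      rw [this]; push_cast; ring
    rw [← AddCircle.coe_add]
    have h0 : (((n / N : ℤ) : ℝ) : AddCircle (1 : ℝ)) = 0 := by
      rw [AddCircle.coe_eq_zero_iff]
      exact ⟨n / N, by simp⟩
    have e : ((n : ZMod N).val : ℝ) / N + (x - n / N) = x - ((n / N : ℤ) : ℝ) := by
      have : ((n : ZMod N).val : ℝ) = n - N * ((n / N : ℤ) : ℝ) := by
        rw [← hv2, ← hv]; simp
      rw [this]; field_simp; ring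
    rw [e, AddCircle.coe_sub, h0, sub_zero]

lemma aux_main (N d k : ℕ) (hN : 0 < N)
    (ε η : ℝ) (hηε : η ≤ ε) (A : Set (Fin d → ZMod N)) :
    sqSet N d ε A + approxHamming d k η ⊆ sqSet N d 0 (A + hammingBall N d k) := by
  rintro _ ⟨_, ⟨_, ⟨a, ha, rfl⟩, q, hq, rfl⟩, u, hu, rfl⟩
  have key : ∀ j, ∃ (m : ZMod N) (s : ℝ), (0 ≤ s ∧ s < 1 / N ∧
      phiMap N d a j + q j + u j
        = (((m.val : ℝ) / N : ℝ) : AddCircle (1 : ℝ)) + (s : AddCircle (1 : ℝ))) ∧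
      (‖u j‖ < η → m = a j) := by
    intro j
    by_cases hj : ‖u j‖ < η
    · obtain ⟨t, ht, e⟩ := aux_lift _ _ hj
      obtain ⟨r, hr1, hr2, e'⟩ := hq j
      rw [abs_lt] at ht
      refine ⟨a j, r + t, ⟨by linarith, by linarith, ?_⟩, fun _ => rfl⟩
      rw [e, e', AddCircle.coe_add, add_assoc]
      rfl
    · obtain ⟨m, s, h⟩ := aux_cell N hN (phiMap N d a j + q j + u j)
      exact ⟨m, s, h, fun h => absurd h hj⟩
  choose m s h1 h2 using key
  refine ⟨phiMap N d m, ⟨m, ⟨a, ha, m - a, ?_, by simp⟩, rfl⟩,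
    fun j => (s j : AddCircle (1 : ℝ)), ?_, ?_⟩
  · refine le_trans (Set.ncard_le_ncard ?_ (Set.toFinite _)) hu
    intro j hj
    by_contra hc
    exact hj (by simp [h2 j (not_le.mp hc)])
  · intro j
    exact ⟨s j, (h1 j).1, by simpa using (h1 j).2.1, rfl⟩
  · funext j
    exact (h1 j).2.2.symm

theorem stmt16 (N d k : ℕ) (hN : 0 < N) (hkd : k < d)
    (ε η : ℝ) (hη : 0 < η) (hηε : η ≤ ε) (A : Set (Fin d → ZMod N)) :
    sqSet N d ε A + approxHamming d k η ⊆ sqSet N d 0 (A + hammingBall N d k) ∧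
      (η < ε →
        closure (sqSet N d ε A + approxHamming d k η) ⊆
          sqSet N d 0 (A + hammingBall N d k)) := by
  refine ⟨aux_main N d k hN ε η hηε A, fun hlt x hx => ?_⟩
  apply aux_main N d k hN ε ε le_rfl A
  obtain ⟨_, ⟨p, hp, u, hu, rfl⟩, hd⟩ := Metric.mem_closure_iff.mp hx (ε - η) (by linarith)
  refine ⟨p, hp, x - p, ?_, by simp⟩
  refine le_trans (Set.ncard_le_ncard ?_ (Set.toFinite _)) hu
  intro j hj
  have h3 : dist (x j) (p j + u j) < ε - η := lt_of_le_of_lt (dist_le_pi_dist x (p + u) j) hd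
  rw [dist_eq_norm] at h3
  have h4 : ε ≤ ‖x j - p j‖ := hj
  have h5 : x j - p j = (x j - (p j + u j)) + u j := by abel
  have h6 := norm_add_le (x j - (p j + u j)) (u j)
  rw [← h5] at h6
  show η ≤ ‖u j‖
  linarith
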